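/- arXiv:2403.02092 — 2 statements merged into one kernel-verified Lean document; each statement's English description precedes it below -/
import Mathlib

section
/- Let a : ℕ → ℕ₀ with a(1) ≤ 1 and let Σ_V be the associated bouquet shift, assumed topologically transitive. Then the entropy at infinity of Σ_V satisfies h_∞ = limsup_{n→∞} (1/n) log a(n) (with the convention that both sides may be +∞). -/
open Filter Set MeasureTheory Real ENNReal

namespace CMS

/-- Points of the full sequence space over the alphabet `ℕ`. -/
abbrev Pt : Type := ℕ → ℕ

/-- The (left) shift map `σ`. -/
def shiftMap : Pt → Pt := fun x i => x (i + 1)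

/-- `x` is a point of the countable Markov shift `Σ` determined by the
transition matrix `M` (identified with a relation on the alphabet `ℕ`). -/
def isAdmissible (M : ℕ → ℕ → Prop) (x : Pt) : Prop := ∀ i, M (x i) (x (i + 1))

/-- Topological transitivity: for all states `a, b` there is `N` with
`[a] ∩ σ⁻ᴺ [b] ≠ ∅`. -/
def TopTransitive (M : ℕ → ℕ → Prop) : Prop :=
  ∀ a b : ℕ, ∃ (N : ℕ) (x : Pt), isAdmissible M x ∧ x 0 = a ∧ x N = b

/-- Birkhoff sum `S_n φ`. -/
noncomputable def birkhoff (φ : Pt → ℝ) (n : ℕ) (x : Pt) : ℝ :=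
  ∑ i ∈ Finset.range n, φ (shiftMap^[i] x)

/-- `φ` has summable variations: `∑_{k ≥ 2} var_k(φ) < ∞`, expressed via a summable
sequence dominating the `k`-th variations. -/
def SummableVariations (M : ℕ → ℕ → Prop) (φ : Pt → ℝ) : Prop :=
  ∃ V : ℕ → ℝ, Summable V ∧
    ∀ k, 2 ≤ k → ∀ x y : Pt, isAdmissible M x → isAdmissible M y →
      (∀ i < k, x i = y i) → |φ x - φ y| ≤ V k

/-- `φ` is weakly Hölder continuous: `var_k(φ) ≤ C θ^k` for all `k ≥ 2`. -/
def WeaklyHolder (M : ℕ → ℕ → Prop) (φ : Pt → ℝ) : Prop :=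
  ∃ C θ : ℝ, 0 < C ∧ 0 < θ ∧ θ < 1 ∧
    ∀ k, 2 ≤ k → ∀ x y : Pt, isAdmissible M x → isAdmissible M y →
      (∀ i < k, x i = y i) → |φ x - φ y| ≤ C * θ ^ k

/-- Periodic points of period `n` in the 1-cylinder `[a]`. -/
def PerSet (M : ℕ → ℕ → Prop) (a n : ℕ) : Set Pt :=
  {x | isAdmissible M x ∧ shiftMap^[n] x = x ∧ x 0 = a}

/-- Periodic points of period `n` in `[a]` whose first return time to `[a]` is `n`. -/
def PerStarSet (M : ℕ → ℕ → Prop) (a n : ℕ) : Set Pt :=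
  {x | isAdmissible M x ∧ shiftMap^[n] x = x ∧ x 0 = a ∧ ∀ k, 0 < k → k < n → x k ≠ a}

/-- The Gurevich partition function `Z_n(φ, a)`. -/
noncomputable def Zn (M : ℕ → ℕ → Prop) (φ : Pt → ℝ) (a n : ℕ) : ℝ≥0∞ :=
  ∑' x : PerSet M a n, ENNReal.ofReal (Real.exp (birkhoff φ n x.1))

/-- The first-return partition function `Z_n^*(φ, a)`. -/
noncomputable def ZnStar (M : ℕ → ℕ → Prop) (φ : Pt → ℝ) (a n : ℕ) : ℝ≥0∞ :=
  ∑' x : PerStarSet M a n, ENNReal.ofReal (Real.exp (birkhoff φ n x.1))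

/-- The Gurevich pressure at the state `a`:
`P(φ) = limsup_n (1/n) log Z_n(φ, a)`, with values in `EReal`. -/
noncomputable def pressureAt (M : ℕ → ℕ → Prop) (φ : Pt → ℝ) (a : ℕ) : EReal :=
  Filter.limsup (fun n : ℕ => ((n : ℝ)⁻¹ : EReal) * ENNReal.log (Zn M φ a n)) atTop

/-- `limsup_n (1/n) log Z_n^*(φ, a)`, with values in `EReal`. -/
noncomputable def pressureStarAt (M : ℕ → ℕ → Prop) (φ : Pt → ℝ) (a : ℕ) : EReal :=
  Filter.limsup (fun n : ℕ => ((n : ℝ)⁻¹ : EReal) * ENNReal.log (ZnStar M φ a n)) atTop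

/-- Strong positive recurrence of `φ`, relative to the common value `P` of the
Gurevich pressure: for some state `a`, `limsup_n (1/n) log Z_n^*(φ,a) < P(φ)`. -/
def SPR (M : ℕ → ℕ → Prop) (φ : Pt → ℝ) (P : ℝ) : Prop :=
  ∃ a : ℕ, pressureStarAt M φ a < (P : EReal)

/-- The `F`-property: for every state `a` and every `n ≥ 1` there are only finitely
many periodic points of period `n` in `[a]`. -/
def FProperty (M : ℕ → ℕ → Prop) : Prop :=
  ∀ a n : ℕ, 0 < n → (PerSet M a n).Finite

/-- `χ_per(φ) = sup { (1/n) S_n φ(x) : σ^n x = x, n ∈ ℕ }`, with values in `EReal`. -/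
noncomputable def chiPer (M : ℕ → ℕ → Prop) (φ : Pt → ℝ) : EReal :=
  ⨆ p : {p : Pt × ℕ // isAdmissible M p.1 ∧ 0 < p.2 ∧ shiftMap^[p.2] p.1 = p.1},
    ((birkhoff φ p.1.2 p.1.1 / (p.1.2 : ℝ) : ℝ) : EReal)

/-- `x` lies in a cylinder belonging to `B(n, M', q)`: it is admissible,
`x 0 ≤ q`, `x n ≤ q` and `#{0 ≤ k ≤ n : x k ≤ q} ≤ (n+1)/M'`. -/
def inBSet (M : ℕ → ℕ → Prop) (n M' q : ℕ) (x : Pt) : Prop :=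
  isAdmissible M x ∧ x 0 ≤ q ∧ x n ≤ q ∧
    ((((Finset.range (n + 1)).filter (fun k => x k ≤ q)).card : ℝ) ≤ (n + 1 : ℝ) / (M' : ℝ))

/-- `z_{φ,n}(M',q) = sup { (1/n) S_n φ(x) : x ∈ B for some B ∈ B(n,M',q) }`. -/
noncomputable def zPhi (M : ℕ → ℕ → Prop) (φ : Pt → ℝ) (n M' q : ℕ) : EReal :=
  ⨆ x : {x : Pt // inBSet M n M' q x}, ((birkhoff φ n x.1 / (n : ℝ) : ℝ) : EReal)

/-- The contraction at infinity
`δ_{φ,∞} = lim_{q→∞} lim_{M'→∞} limsup_{n→∞} z_{φ,n}(M',q)`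
(the inner limits exist by monotonicity, so they agree with `liminf`s). -/
noncomputable def deltaInf (M : ℕ → ℕ → Prop) (φ : Pt → ℝ) : EReal :=
  liminf (fun q : ℕ => liminf (fun M' : ℕ =>
    limsup (fun n : ℕ => zPhi M φ n M' q) atTop) atTop) atTop

/-- `z_n(M',q) = #B(n,M',q)`, the number of `(n+1)`-cylinders (i.e. admissible
words realized in `Σ`) in `B(n,M',q)`, counted in `ℝ≥0∞`. -/
noncomputable def zCount (M : ℕ → ℕ → Prop) (n M' q : ℕ) : ℝ≥0∞ :=
  ∑' _w : {w : Fin (n + 1) → ℕ //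
      (∃ x : Pt, isAdmissible M x ∧ ∀ i : Fin (n + 1), x (i : ℕ) = w i) ∧
      w 0 ≤ q ∧ w (Fin.last n) ≤ q ∧
      (((Finset.univ.filter (fun i : Fin (n + 1) => w i ≤ q)).card : ℝ) ≤ (n + 1 : ℝ) / (M' : ℝ))},
    (1 : ℝ≥0∞)

/-- The entropy at infinity
`h_∞ = lim_{q→∞} lim_{M'→∞} limsup_{n→∞} (1/n) log z_n(M',q)`. -/
noncomputable def hInfty (M : ℕ → ℕ → Prop) : EReal :=
  liminf (fun q : ℕ => liminf (fun M' : ℕ =>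
    limsup (fun n : ℕ => ((n : ℝ)⁻¹ : EReal) * ENNReal.log (zCount M n M' q)) atTop) atTop) atTop

end CMS

namespace CMS

/-- The vertex set of the bouquet graph determined by `a : ℕ → ℕ` (with
`a 1 ≤ 1`): the root, encoded as `(0,0,0)`, together with the vertices
`v_k^{n,i}` (encoded `(n,i,k)`) for `n ≥ 2`, `1 ≤ i ≤ a n`, `1 ≤ k ≤ n-1`. -/
def BouquetVertex (a : ℕ → ℕ) : Set (ℕ × ℕ × ℕ) :=
  {p | p = (0, 0, 0) ∨
    (2 ≤ p.1 ∧ 1 ≤ p.2.1 ∧ p.2.1 ≤ a p.1 ∧ 1 ≤ p.2.2 ∧ p.2.2 ≤ p.1 - 1)}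

/-- The edges of the bouquet graph determined by `a : ℕ → ℕ`: the transitions
along the `a n` disjoint simple loops of length `n` based at the root
(`a 1 = 1` meaning the self-loop at the root is present). -/
def BouquetEdge (a : ℕ → ℕ) : (ℕ × ℕ × ℕ) → (ℕ × ℕ × ℕ) → Prop := fun u v =>
  (u = (0, 0, 0) ∧ v = (0, 0, 0) ∧ a 1 = 1) ∨
  (u = (0, 0, 0) ∧ ∃ n i : ℕ, 2 ≤ n ∧ 1 ≤ i ∧ i ≤ a n ∧ v = (n, i, 1)) ∨
  (∃ n i k : ℕ, 2 ≤ n ∧ 1 ≤ i ∧ i ≤ a n ∧ 1 ≤ k ∧ k + 1 ≤ n - 1 ∧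
    u = (n, i, k) ∧ v = (n, i, k + 1)) ∨
  (∃ n i : ℕ, 2 ≤ n ∧ 1 ≤ i ∧ i ≤ a n ∧ u = (n, i, n - 1) ∧ v = (0, 0, 0))

/-- The transition matrix `M` on the alphabet `ℕ` is (a presentation of) the
bouquet shift `Σ_V` of `a`, via the enumeration `e` of the vertices with
`e 0` the root.  (All the quantities appearing in our statements are
independent of the chosen enumeration.) -/
def IsBouquet (a : ℕ → ℕ) (M : ℕ → ℕ → Prop) (e : ℕ → ℕ × ℕ × ℕ) : Prop :=
  Function.Injective e ∧ Set.range e = BouquetVertex a ∧ e 0 = (0, 0, 0) ∧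
    ∀ u v : ℕ, M u v ↔ BouquetEdge a (e u) (e v)

end CMS

open CMS

section PathSums

lemma tsum_prod_path_le {α : Type*} (A : α → α → ℝ≥0∞) (g h : α → ℝ≥0∞) (κ : ℝ≥0∞)
    (H : ∀ u, ∑' v, A u v * h v ≤ κ * h u) (n : ℕ) :
    ∑' w : Fin (n + 1) → α,
      g (w 0) * (∏ i : Fin n, A (w i.castSucc) (w i.succ)) * h (w (Fin.last n))
        ≤ κ ^ n * ∑' u, g u * h u := by
  induction n with
  | zero =>
    rw [← (Equiv.funUnique (Fin 1) α).symm.tsum_eq]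
    simp
  | succ n ih =>
    rw [← (Fin.snocEquiv (fun _ : Fin (n + 2) => α)).tsum_eq, ENNReal.tsum_prod',
      ENNReal.tsum_comm]
    calc _ = ∑' w : Fin (n + 1) → α,
          g (w 0) * (∏ i : Fin n, A (w i.castSucc) (w i.succ)) *
            ∑' v, A (w (Fin.last n)) v * h v := by
          refine tsum_congr fun w => ?_
          rw [← ENNReal.tsum_mul_left]
          refine tsum_congr fun v => ?_
          have h0 : (Fin.snoc w v : Fin (n + 2) → α) 0 = w 0 :=
            Fin.snoc_castSucc (α := fun _ => α) v w 0
          have hs : ∀ i : Fin n, (Fin.snoc w v : Fin (n + 2) → α) i.castSucc.succ = w i.succ :=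
            fun i => Fin.snoc_castSucc (α := fun _ => α) v w i.succ
          simp only [Fin.snocEquiv_apply, Fin.prod_univ_castSucc, Fin.snoc_castSucc, hs, h0,
            Fin.succ_last, Fin.snoc_last]
          ring
      _ ≤ ∑' w : Fin (n + 1) → α,
          g (w 0) * (∏ i : Fin n, A (w i.castSucc) (w i.succ)) * (κ * h (w (Fin.last n))) := by
          gcongr; exact H _
      _ = κ * ∑' w : Fin (n + 1) → α,
          g (w 0) * (∏ i : Fin n, A (w i.castSucc) (w i.succ)) * h (w (Fin.last n)) := by
          rw [← ENNReal.tsum_mul_left]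
          exact tsum_congr fun w => by ring
      _ ≤ κ * (κ ^ n * ∑' u, g u * h u) := by gcongr
      _ = _ := by ring

lemma ofReal_exp_mul (x y : ℝ) :
    ENNReal.ofReal (Real.exp x) * ENNReal.ofReal (Real.exp y) =
      ENNReal.ofReal (Real.exp (x + y)) := by
  rw [← ENNReal.ofReal_mul (Real.exp_nonneg _), Real.exp_add]

lemma ofReal_exp_pow (x : ℝ) (n : ℕ) :
    ENNReal.ofReal (Real.exp x) ^ n = ENNReal.ofReal (Real.exp (n * x)) := by
  rw [← ENNReal.ofReal_pow (Real.exp_nonneg _), Real.exp_nat_mul]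

lemma inv_mul_log_le_iff {n : ℕ} (hn : 0 < n) (z : ℝ≥0∞) (x : ℝ) :
    ((n : ℝ)⁻¹ : EReal) * ENNReal.log z ≤ (x : EReal) ↔
      z ≤ ENNReal.ofReal (Real.exp (n * x)) := by
  have h1 : (0 : EReal) < ((n : ℝ) : EReal) := by exact_mod_cast hn
  rw [← EReal.div_eq_inv_mul, EReal.div_le_iff_le_mul h1 (EReal.coe_ne_top _),
    ← EReal.coe_mul, ← EReal.exp_coe, ← ENNReal.log_le_log_iff, EReal.log_exp]

end PathSums

section Bouquet

/-- The number of steps from a vertex of the bouquet graph to the root. -/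
def distToRoot (p : ℕ × ℕ × ℕ) : ℕ := p.1 - p.2.2

/-- The weight of a transition of `M`: each departure from the state `0` costs a factor `T`. -/
noncomputable def rootWeight (M : ℕ → ℕ → Prop) (T : ℝ≥0∞) (u v : ℕ) : ℝ≥0∞ :=
  open Classical in if M u v then (if u = 0 then T else 1) else 0

variable {a : ℕ → ℕ} {M : ℕ → ℕ → Prop} {e : ℕ → ℕ × ℕ × ℕ}

lemma tsum_rootEdge_le (a : ℕ → ℕ) (F : ℕ × ℕ × ℕ → ℝ≥0∞) (B : ℕ → ℝ≥0∞)
    (hF : ∀ n i, F (n, i, 1) ≤ B n) :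
    ∑' p, {p | BouquetEdge a (0, 0, 0) p}.indicator F p
      ≤ F (0, 0, 0) + ∑' n, (a n : ℝ≥0∞) * B n := by
  classical
  calc _ ≤ ∑' p : ℕ × ℕ × ℕ, ((if p = (0, 0, 0) then F (0, 0, 0) else 0) +
        (if p.2.1 ∈ Finset.Icc 1 (a p.1) then (if p.2.2 = 1 then B p.1 else 0) else 0)) := by
        refine ENNReal.tsum_le_tsum fun p => ?_
        by_cases hp : BouquetEdge a (0, 0, 0) p
        · rw [Set.indicator_of_mem (by exact hp)]
          rcases hp with ⟨-, rfl, -⟩ | ⟨-, n, i, -, hi, hi', rfl⟩ | ⟨n, i, k, hn, -, -, -, -, h, -⟩ |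
            ⟨n, i, hn, -, -, h, -⟩
          · simp
          · simpa [hi, hi'] using hF n i
          · simp at h; omega
          · simp at h; omega
        · rw [Set.indicator_of_notMem (by exact hp)]
          exact zero_le
    _ = F (0, 0, 0) + ∑' n, (a n : ℝ≥0∞) * B n := by
        rw [ENNReal.tsum_add, tsum_ite_eq, ENNReal.tsum_prod']
        congr 1
        refine tsum_congr fun n => ?_
        rw [ENNReal.tsum_prod']
        simp only
        rw [tsum_eq_sum (s := Finset.Icc 1 (a n))]
        · rw [Finset.sum_congr rfl (g := fun _ => B n)]
          · simp
          · intro i hi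
            simp only [hi, if_true]
            exact tsum_ite_eq 1 _
        · intro i hi
          simp [hi]

lemma BouquetEdge.eq_next {u v : ℕ × ℕ × ℕ} (hu : u ≠ (0, 0, 0)) (h : BouquetEdge a u v) :
    v = (if u.2.2 + 1 ≤ u.1 - 1 then (u.1, u.2.1, u.2.2 + 1) else (0, 0, 0)) := by
  rcases h with ⟨h, -⟩ | ⟨h, -⟩ | ⟨n, i, k, hn, -, -, -, hk, rfl, rfl⟩ | ⟨n, i, hn, -, -, rfl, rfl⟩
  · exact absurd h hu
  · exact absurd h hu
  · simp [hk]
  · simp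

lemma BouquetEdge.distToRoot_succ {u v : ℕ × ℕ × ℕ} (hu : u ≠ (0, 0, 0))
    (h : BouquetEdge a u v) : distToRoot v + 1 = distToRoot u := by
  rcases h with ⟨h, -⟩ | ⟨h, -⟩ | ⟨n, i, k, hn, -, -, -, hk, rfl, rfl⟩ | ⟨n, i, hn, -, -, rfl, rfl⟩
  · exact absurd h hu
  · exact absurd h hu
  · simp only [distToRoot]; omega
  · simp only [distToRoot]; omega

lemma tsum_rootWeight_mul_le (hbq : IsBouquet a M e) {s : ℝ} {T : ℝ≥0∞}
    (hT : T * (1 + ∑' n, (a n : ℝ≥0∞) * ENNReal.ofReal (Real.exp (s * (1 - n)))) ≤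
      ENNReal.ofReal (Real.exp s)) (hs : 0 ≤ s) (u : ℕ) :
    ∑' v, rootWeight M T u v * ENNReal.ofReal (Real.exp (-(s * distToRoot (e v)))) ≤
      ENNReal.ofReal (Real.exp s) * ENNReal.ofReal (Real.exp (-(s * distToRoot (e u)))) := by
  obtain ⟨he, -, he0, hM⟩ := hbq
  by_cases hu : u = 0
  · subst hu
    set F : ℕ × ℕ × ℕ → ℝ≥0∞ := fun p => ENNReal.ofReal (Real.exp (-(s * distToRoot p))) with hF
    have h0 : F (0, 0, 0) = 1 := by simp [hF, distToRoot]
    calc _ = T * ∑' v, {p | BouquetEdge a (0, 0, 0) p}.indicator F (e v) := by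
          rw [← ENNReal.tsum_mul_left]
          refine tsum_congr fun v => ?_
          by_cases h : M 0 v
          · have h' := (hM _ _).1 h
            rw [he0] at h'
            rw [Set.indicator_of_mem (by exact h')]
            simp [rootWeight, h, hF]
          · have h' := mt (hM _ _).2 h
            rw [he0] at h'
            rw [Set.indicator_of_notMem (by exact h')]
            simp [rootWeight, h]
      _ ≤ T * ∑' p, {p | BouquetEdge a (0, 0, 0) p}.indicator F p := by
          gcongr
          exact ENNReal.tsum_comp_le_tsum_of_injective he _
      _ ≤ T * (1 + ∑' n, (a n : ℝ≥0∞) * ENNReal.ofReal (Real.exp (s * (1 - n)))) := by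
          rw [← h0]
          gcongr
          refine tsum_rootEdge_le a F _ fun n i => ?_
          refine ENNReal.ofReal_le_ofReal (Real.exp_le_exp.2 ?_)
          have : (n : ℝ) ≤ (n - 1 : ℕ) + 1 := by exact_mod_cast (by omega : n ≤ n - 1 + 1)
          simp only [distToRoot]
          nlinarith
      _ ≤ _ := by rw [he0]; simpa [hF, distToRoot] using hT
  · have hu' : e u ≠ (0, 0, 0) := fun h => hu (he (h.trans he0.symm))
    by_cases hv : ∃ v, M u v
    · obtain ⟨v, hv⟩ := hv
      have hv' := (hM _ _).1 hv
      rw [tsum_eq_single v]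
      · rw [ofReal_exp_mul]
        simp only [rootWeight, hv, hu, if_true, if_false, one_mul]
        refine ENNReal.ofReal_le_ofReal (Real.exp_le_exp.2 ?_)
        rw [← BouquetEdge.distToRoot_succ hu' hv']
        push_cast
        linarith
      · intro v' hne
        have : ¬ M u v' := fun h =>
          hne (he ((BouquetEdge.eq_next hu' ((hM _ _).1 h)).trans (BouquetEdge.eq_next hu' hv').symm))
        simp [rootWeight, this]
    · push Not at hv
      simp [rootWeight, hv]

lemma le_prod_rootWeight {n : ℕ} {w : Fin (n + 1) → ℕ} {τ K : ℝ} (hτ : 0 ≤ τ)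
    (hw : ∀ i : Fin n, M (w i.castSucc) (w i.succ))
    (hK : ((Finset.univ.filter (fun i => w i = 0)).card : ℝ) ≤ K) :
    ENNReal.ofReal (Real.exp (-(τ * K))) ≤
      ∏ i : Fin n, rootWeight M (ENNReal.ofReal (Real.exp (-τ))) (w i.castSucc) (w i.succ) := by
  simp only [rootWeight, hw, if_true]
  rw [Finset.prod_ite, Finset.prod_const_one, mul_one, Finset.prod_const, ofReal_exp_pow]
  refine ENNReal.ofReal_le_ofReal (Real.exp_le_exp.2 ?_)
  have : ((Finset.univ.filter (fun i : Fin n => w i.castSucc = 0)).card : ℝ) ≤ K := by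
    refine le_trans ?_ hK
    norm_cast
    refine Finset.card_le_card_of_injOn Fin.castSucc ?_ (Fin.castSucc_injective n).injOn
    intro i hi
    simpa using hi
  nlinarith

lemma zCount_le (hbq : IsBouquet a M e) {s τ : ℝ} (hs : 0 ≤ s) (hτ : 0 ≤ τ)
    (hT : ENNReal.ofReal (Real.exp (-τ)) *
      (1 + ∑' n, (a n : ℝ≥0∞) * ENNReal.ofReal (Real.exp (s * (1 - n)))) ≤
        ENNReal.ofReal (Real.exp s)) (q : ℕ) :
    ∃ c : ℝ, ∀ n M' : ℕ, zCount M n M' q ≤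
      ENNReal.ofReal (Real.exp (c + s * n + τ * ((n + 1) / M'))) := by
  classical
  obtain ⟨m, hm⟩ : ∃ m : ℕ, ∀ u ≤ q, distToRoot (e u) ≤ m :=
    ⟨(Finset.range (q + 1)).sup fun u => distToRoot (e u), fun u hu =>
      Finset.le_sup (f := fun u => distToRoot (e u)) (by simpa using Nat.lt_succ_of_le hu)⟩
  refine ⟨s * m + Real.log (q + 1), fun n M' => ?_⟩
  set h : ℕ → ℝ≥0∞ := fun v => ENNReal.ofReal (Real.exp (-(s * distToRoot (e v)))) with hh
  set g : ℕ → ℝ≥0∞ := fun u => if u ∈ Finset.range (q + 1) then 1 else 0 with hg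
  set A := rootWeight M (ENNReal.ofReal (Real.exp (-τ))) with hA
  set C := ENNReal.ofReal (Real.exp (τ * ((n + 1) / M') + s * m)) with hC
  have hgh : ∑' u, g u * h u ≤ ENNReal.ofReal (Real.exp (Real.log (q + 1))) := by
    rw [Real.exp_log (by positivity)]
    calc ∑' u, g u * h u ≤ ∑' u, g u := by
          refine ENNReal.tsum_le_tsum fun u => mul_le_of_le_one_right' ?_
          simp only [hh]
          rw [ENNReal.ofReal_le_one, Real.exp_le_one_iff]
          have : 0 ≤ s * distToRoot (e u) := by positivity
          linarith
      _ = ∑ u ∈ Finset.range (q + 1), g u := tsum_eq_sum fun u hu => by simp only [hg, hu, if_false]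
      _ = ∑ u ∈ Finset.range (q + 1), 1 := Finset.sum_congr rfl fun u hu => by
          simp only [hg, hu, if_true]
      _ = ENNReal.ofReal (q + 1) := by
          rw [Finset.sum_const, Finset.card_range, nsmul_one]
          exact_mod_cast (ENNReal.ofReal_natCast (q + 1)).symm
  calc zCount M n M' q
      ≤ ∑' w : Fin (n + 1) → ℕ,
        C * (g (w 0) * (∏ i : Fin n, A (w i.castSucc) (w i.succ)) * h (w (Fin.last n))) := by
        refine le_trans (ENNReal.tsum_le_tsum ?_)
          (ENNReal.tsum_comp_le_tsum_of_injective Subtype.val_injective _)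
        rintro ⟨w, ⟨x, hx, hxw⟩, hw0, hwn, hcard⟩
        have hadm : ∀ i : Fin n, M (w i.castSucc) (w i.succ) := fun i => by
          rw [← hxw, ← hxw]; exact hx i
        have hK := le_prod_rootWeight hτ hadm (K := (n + 1) / M') (by
          refine le_trans ?_ hcard
          norm_cast
          exact Finset.card_le_card (Finset.monotone_filter_right _ fun i _ hi => by omega))
        have hg0 : g (w 0) = 1 := if_pos (by simpa using Nat.lt_succ_of_le hw0)
        have hlast : ENNReal.ofReal (Real.exp (-(s * m))) ≤ h (w (Fin.last n)) := by
          refine ENNReal.ofReal_le_ofReal (Real.exp_le_exp.2 (neg_le_neg ?_))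
          gcongr
          exact hm _ hwn
        calc (1 : ℝ≥0∞) = C * (1 * ENNReal.ofReal (Real.exp (-(τ * ((n + 1) / M')))) *
              ENNReal.ofReal (Real.exp (-(s * m)))) := by
              rw [one_mul, ofReal_exp_mul, ofReal_exp_mul]
              ring_nf
              simp
          _ ≤ _ := by
              simp only [hg0]
              gcongr
    _ = C * ∑' w : Fin (n + 1) → ℕ,
        (g (w 0) * (∏ i : Fin n, A (w i.castSucc) (w i.succ)) * h (w (Fin.last n))) :=
        ENNReal.tsum_mul_left
    _ ≤ C * (ENNReal.ofReal (Real.exp s) ^ n * ∑' u, g u * h u) := by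
        gcongr
        exact tsum_prod_path_le A g h _ (tsum_rootWeight_mul_le hbq hT hs) n
    _ ≤ C * (ENNReal.ofReal (Real.exp s) ^ n * ENNReal.ofReal (Real.exp (Real.log (q + 1)))) := by
        gcongr
    _ = _ := by
        rw [hC, ofReal_exp_pow, ofReal_exp_mul, ofReal_exp_mul]
        ring_nf

lemma tsum_loops_lt_top {l s : ℝ} (hls : l < s)
    (ha : ∀ᶠ n : ℕ in atTop, (a n : ℝ≥0∞) ≤ ENNReal.ofReal (Real.exp (n * l))) :
    ∑' n, (a n : ℝ≥0∞) * ENNReal.ofReal (Real.exp (s * (1 - n))) < ⊤ := by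
  obtain ⟨N, hN⟩ := eventually_atTop.1 ha
  rw [← ENNReal.summable.sum_add_tsum_nat_add' (k := N)]
  refine ENNReal.add_lt_top.2 ⟨?_, ?_⟩
  · exact ENNReal.sum_lt_top.2 fun n _ =>
      ENNReal.mul_lt_top (ENNReal.natCast_lt_top _) ENNReal.ofReal_lt_top
  · calc _ ≤ ∑' n : ℕ, ENNReal.ofReal (Real.exp (s + N * (l - s))) *
          ENNReal.ofReal (Real.exp (l - s)) ^ n := by
          refine ENNReal.tsum_le_tsum fun n => ?_
          refine (mul_le_mul_left (hN (n + N) (by omega)) _).trans (le_of_eq ?_)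
          rw [ofReal_exp_pow, ofReal_exp_mul, ofReal_exp_mul]
          push_cast
          ring_nf
      _ < ⊤ := by
          rw [ENNReal.tsum_mul_left, ENNReal.tsum_geometric]
          refine ENNReal.mul_lt_top ENNReal.ofReal_lt_top ?_
          rw [ENNReal.inv_lt_top, tsub_pos_iff_lt, ENNReal.ofReal_lt_one, Real.exp_lt_one_iff]
          linarith

lemma hInfty_le_of_limsup_lt (hbq : IsBouquet a M e) {l c : ℝ} (hl : 0 ≤ l) (hlc : l < c)
    (ha : ∀ᶠ n : ℕ in atTop, (a n : ℝ≥0∞) ≤ ENNReal.ofReal (Real.exp (n * l))) :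
    hInfty M ≤ (c : EReal) := by
  obtain ⟨s, hls, hsc⟩ := exists_between hlc
  have hs : 0 < s := hl.trans_lt hls
  have hQ := (ENNReal.add_lt_top.2 ⟨ENNReal.one_lt_top, tsum_loops_lt_top hls ha⟩).ne
  set Q := 1 + ∑' n, (a n : ℝ≥0∞) * ENNReal.ofReal (Real.exp (s * (1 - n))) with hQdef
  have hQ1 : 1 ≤ Q.toReal := by
    rw [← ENNReal.toReal_one]
    exact ENNReal.toReal_mono hQ (hQdef ▸ le_self_add)
  set τ := Real.log Q.toReal with hτdef
  have hτ : 0 ≤ τ := Real.log_nonneg hQ1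
  have hT : ENNReal.ofReal (Real.exp (-τ)) * Q ≤ ENNReal.ofReal (Real.exp s) := by
    have : Q = ENNReal.ofReal (Real.exp τ) := by
      rw [hτdef, Real.exp_log (by linarith), ENNReal.ofReal_toReal hQ]
    rw [this, ofReal_exp_mul]
    exact ENNReal.ofReal_le_ofReal (Real.exp_le_exp.2 (by linarith))
  have key : ∀ q : ℕ, liminf (fun M' : ℕ =>
      limsup (fun n : ℕ => ((n : ℝ)⁻¹ : EReal) * ENNReal.log (zCount M n M' q)) atTop) atTop
        ≤ (c : EReal) := fun q => by
    obtain ⟨C, hC⟩ := zCount_le hbq hs.le hτ hT q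
    refine (liminf_le_limsup (by isBoundedDefault) (by isBoundedDefault)).trans (limsup_le_of_le (by isBoundedDefault) ?_)
    have hM : ∀ᶠ M' : ℕ in atTop, τ / M' < (c - s) / 2 :=
      (tendsto_const_div_atTop_nhds_zero_nat τ).eventually_lt_const (by linarith)
    filter_upwards [hM] with M' hM'
    refine limsup_le_of_le (by isBoundedDefault) ?_
    have hn : ∀ᶠ n : ℕ in atTop, (C + τ / M') / n < (c - s) / 2 :=
      (tendsto_const_div_atTop_nhds_zero_nat _).eventually_lt_const (by linarith)
    filter_upwards [hn, eventually_gt_atTop 0] with n hn hn0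
    rw [inv_mul_log_le_iff hn0]
    refine (hC n M').trans (ENNReal.ofReal_le_ofReal (Real.exp_le_exp.2 ?_))
    have hn0' : (0 : ℝ) < n := by exact_mod_cast hn0
    rw [div_lt_iff₀ hn0'] at hn
    have : τ * ((n + 1) / M') = τ / M' * n + τ / M' := by ring
    nlinarith
  exact (liminf_le_limsup (by isBoundedDefault) (by isBoundedDefault)).trans (limsup_le_of_le (by isBoundedDefault) (Eventually.of_forall key))

lemma frequently_one_le (hbq : IsBouquet a M e) : ∃ᶠ n in atTop, 1 ≤ a n := by
  obtain ⟨he, hr, -, -⟩ := hbq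
  intro h
  obtain ⟨N, hN⟩ := eventually_atTop.1 h
  refine Set.infinite_range_of_injective he (hr ▸ Set.Finite.subset
    (Finset.finite_toSet (Finset.range (N + 1) ×ˢ
      Finset.range ((Finset.range N).sup a + 1) ×ˢ Finset.range (N + 1))) ?_)
  rintro ⟨n, i, k⟩ (h | ⟨-, h1, h2, -, h3⟩)
  · simp_all
  · simp only at h1 h2 h3
    have hn : n < N := by
      by_contra hn
      exact hN n (by omega) (by omega)
    have := Finset.le_sup (f := a) (Finset.mem_range.2 hn)
    simp
    omega

/-- The periodic sequence of vertices running along the `i`-th loop of length `n`. -/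
def loopVertex (n i j : ℕ) : ℕ × ℕ × ℕ := if j % n = 0 then (0, 0, 0) else (n, i, j % n)

lemma loopVertex_mem {n i : ℕ} (hn : 2 ≤ n) (hi : 1 ≤ i) (hi' : i ≤ a n) (j : ℕ) :
    loopVertex n i j ∈ BouquetVertex a := by
  unfold loopVertex
  split_ifs with h
  · exact Or.inl rfl
  · have := Nat.mod_lt j (by omega : n > 0)
    exact Or.inr ⟨hn, hi, hi', by simp only; omega, by simp only; omega⟩

lemma bouquetEdge_loopVertex {n i : ℕ} (hn : 2 ≤ n) (hi : 1 ≤ i) (hi' : i ≤ a n) (j : ℕ) :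
    BouquetEdge a (loopVertex n i j) (loopVertex n i (j + 1)) := by
  unfold loopVertex
  have h1 := Nat.mod_lt j (by omega : n > 0)
  have h2 : (j + 1) % n = if j % n + 1 = n then 0 else j % n + 1 := by
    rw [Nat.add_mod, Nat.mod_eq_of_lt (by omega : 1 < n)]
    split_ifs with h
    · rw [h, Nat.mod_self]
    · exact Nat.mod_eq_of_lt (by omega)
  rw [h2]
  generalize j % n = k at *
  by_cases h : k + 1 = n
  · subst h
    simp only [if_true, if_neg (by omega : ¬k = 0)]
    exact Or.inr (Or.inr (Or.inr ⟨k + 1, i, hn, hi, hi', rfl, rfl⟩))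
  · simp only [if_neg h, if_neg k.succ_ne_zero]
    by_cases h0 : k = 0
    · subst h0
      exact Or.inr (Or.inl ⟨rfl, n, i, hn, hi, hi', rfl⟩)
    · rw [if_neg h0]
      exact Or.inr (Or.inr (Or.inl ⟨n, i, k, hn, hi, hi', by omega, by omega, rfl, rfl⟩))

lemma natCast_le_zCount (hbq : IsBouquet a M e) {n M' q : ℕ} (hM' : 0 < M')
    (hn : M' * (q + 2) ≤ n) : (a n : ℝ≥0∞) ≤ zCount M n M' q := by
  obtain ⟨he, hr, he0, hM⟩ := hbq
  have hn2 : 2 ≤ n := by nlinarith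
  have hex : ∀ i : Fin (a n), ∃ x : Pt, ∀ j, e (x j) = loopVertex n (i + 1) j := fun i =>
    Classical.skolem.1 fun j => by
      have := loopVertex_mem hn2 (by omega : 1 ≤ (i : ℕ) + 1) (by omega : (i : ℕ) + 1 ≤ a n) j
      rwa [← hr] at this
  choose x hx using hex
  have hroot : ∀ i j, j % n = 0 → x i j = 0 := fun i j hj => he (by simp [hx, he0, loopVertex, hj])
  have hinj : ∀ i j k, j < n → k < n → x i j = x i k → j = k := fun i j k hj hk h => by
    have := congrArg e h
    rw [hx, hx] at this
    simp only [loopVertex, Nat.mod_eq_of_lt hj, Nat.mod_eq_of_lt hk] at this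
    split_ifs at this <;> simp at this <;> omega
  let f : Fin (a n) → {w : Fin (n + 1) → ℕ //
      (∃ x : Pt, isAdmissible M x ∧ ∀ i : Fin (n + 1), x (i : ℕ) = w i) ∧
      w 0 ≤ q ∧ w (Fin.last n) ≤ q ∧
      (((Finset.univ.filter (fun i : Fin (n + 1) => w i ≤ q)).card : ℝ) ≤
        (n + 1 : ℝ) / (M' : ℝ))} := fun i => ⟨fun j => x i j, ⟨x i, fun j => by
          rw [hM, hx, hx]
          exact bouquetEdge_loopVertex hn2 (by omega) (by omega) j, fun _ => rfl⟩,
          by simp [hroot i 0 (Nat.zero_mod n)], by simp [hroot i n (Nat.mod_self n)], by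
      have hcard : (Finset.univ.filter (fun j : Fin (n + 1) => x i j ≤ q)).card ≤ q + 2 := by
        rw [← Finset.card_range (q + 2)]
        refine Finset.card_le_card_of_injOn
          (fun j => if (j : ℕ) = n then q + 1 else x i j) ?_ ?_
        · intro j hj
          have hj : x i j ≤ q := by simpa using hj
          simp only [Finset.coe_range, Set.mem_Iio]
          split_ifs <;> omega
        · intro j hj k hk hjk
          have hj : x i j ≤ q := by simpa using hj
          have hk : x i k ≤ q := by simpa using hk
          simp only at hjk
          have := j.2
          have := k.2
          ext
          split_ifs at hjk
          · omega
          · omega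
          · omega
          · exact hinj i j k (by omega) (by omega) hjk
      rw [le_div_iff₀ (by exact_mod_cast hM')]
      norm_cast
      nlinarith⟩
  have hf : Function.Injective f := fun i k hik => by
    have h1 := congrFun (congrArg Subtype.val hik) ⟨1, by omega⟩
    have h2 := congrArg e h1
    simp only [f, hx, loopVertex, Nat.mod_eq_of_lt (by omega : 1 < n)] at h2
    ext
    simpa using h2
  calc (a n : ℝ≥0∞) = ∑' _ : Fin (a n), (1 : ℝ≥0∞) := by simp
    _ ≤ zCount M n M' q := ENNReal.tsum_comp_le_tsum_of_injective hf (fun _ => 1)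

lemma limsup_le_hInfty (hbq : IsBouquet a M e) :
    limsup (fun n : ℕ => ((n : ℝ)⁻¹ : EReal) * ENNReal.log ((a n : ℝ≥0∞))) atTop ≤ hInfty M := by
  refine le_liminf_of_le (by isBoundedDefault) (Eventually.of_forall fun q => ?_)
  refine le_liminf_of_le (by isBoundedDefault) ?_
  filter_upwards [eventually_gt_atTop 0] with M' hM'
  refine limsup_le_limsup ?_
  filter_upwards [eventually_ge_atTop (M' * (q + 2))] with n hn
  refine mul_le_mul_of_nonneg_left (ENNReal.log_le_log (natCast_le_zCount hbq hM' hn)) ?_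
  exact EReal.inv_nonneg_of_nonneg (by exact_mod_cast n.zero_le)

lemma limsup_nonneg (hbq : IsBouquet a M e) :
    0 ≤ limsup (fun n : ℕ => ((n : ℝ)⁻¹ : EReal) * ENNReal.log ((a n : ℝ≥0∞))) atTop := by
  refine le_limsup_of_frequently_le' ((frequently_one_le hbq).mono fun n hn => ?_)
  refine mul_nonneg (EReal.inv_nonneg_of_nonneg (by exact_mod_cast n.zero_le)) ?_
  rw [ENNReal.zero_le_log_iff]
  exact_mod_cast hn

end Bouquet

/-- Lemma `lem:hinfa(n)`.
For the bouquet shift associated to `a : ℕ → ℕ` (with `a 1 ≤ 1`), assumed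
topologically transitive, the entropy at infinity satisfies
`h_∞ = limsup_{n→∞} (1/n) log a(n)` (both sides taken in `EReal`, so that
either may equal `+∞`). -/
theorem bouquet_entropy_at_infinity
    (a : ℕ → ℕ) (ha1 : a 1 ≤ 1)
    (M : ℕ → ℕ → Prop) (e : ℕ → ℕ × ℕ × ℕ)
    (hbq : IsBouquet a M e)
    (htrans : TopTransitive M) :
    hInfty M =
      Filter.limsup (fun n : ℕ => ((n : ℝ)⁻¹ : EReal) * ENNReal.log ((a n : ℝ≥0∞))) Filter.atTop := by
  refine le_antisymm (EReal.le_of_forall_lt_iff_le.1 fun c hc => ?_) (limsup_le_hInfty hbq)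
  obtain ⟨l, hl, hlc⟩ := EReal.lt_iff_exists_real_btwn.1 hc
  have hl0 : 0 ≤ l := by exact_mod_cast ((limsup_nonneg hbq).trans_lt hl).le
  refine hInfty_le_of_limsup_lt hbq hl0 (by exact_mod_cast hlc) ?_
  filter_upwards [eventually_lt_of_limsup_lt hl, eventually_gt_atTop 0] with n hn hn0
  exact (inv_mul_log_le_iff hn0 _ _).1 hn.le
end

section
/- Let (Σ,σ) be a topologically transitive countable Markov shift with the F-property and φ : Σ → ℝ a potential with summable variations and P(φ) < ∞. Then χ_per(φ) := sup{(1/n)S_nφ(x) : σ^n x = x, n ∈ ℕ} = sup{∫φ dμ : μ ∈ M(Σ)}, where the supremum on the right is over all σ-invariant Borel probability measures μ on Σ for which ∫φ dμ is well-defined in [−∞,∞). -/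
open Filter Set MeasureTheory Real ENNReal

open CMS

namespace CMS

/-- `μ` is a `σ`-invariant Borel probability measure on `Σ`. -/
def InvariantProb (M : ℕ → ℕ → Prop) (μ : MeasureTheory.Measure Pt) : Prop :=
  MeasureTheory.IsProbabilityMeasure μ ∧
    μ {x : Pt | isAdmissible M x} = 1 ∧
    MeasureTheory.Measure.map shiftMap μ = μ

/-- The integral `∫ φ dμ` with values in `EReal` (defined whenever the positive
part is finite, i.e. the integral is well defined in `[-∞, ∞)`). -/
noncomputable def integralEReal (μ : MeasureTheory.Measure Pt) (φ : Pt → ℝ) : EReal :=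
  ((∫⁻ x, ENNReal.ofReal (φ x) ∂μ : ℝ≥0∞) : EReal) -
    ((∫⁻ x, ENNReal.ofReal (-(φ x)) ∂μ : ℝ≥0∞) : EReal)

end CMS

namespace CMS

variable {M : ℕ → ℕ → Prop} {φ : Pt → ℝ} {x : Pt}

lemma shiftMap_iterate_apply (k : ℕ) (x : Pt) (i : ℕ) : shiftMap^[k] x i = x (i + k) := by
  induction k generalizing x with
  | zero => simp
  | succ k ih => rw [Function.iterate_succ_apply, ih, shiftMap, add_assoc]

lemma measurable_shiftMap : Measurable shiftMap :=
  measurable_pi_lambda _ fun i => measurable_pi_apply (i + 1)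

lemma isAdmissible.iterate (hx : isAdmissible M x) (k : ℕ) :
    isAdmissible M (shiftMap^[k] x) := fun i => by
  simpa only [shiftMap_iterate_apply, Nat.add_right_comm] using hx (i + k)

lemma isClosed_isAdmissible (M : ℕ → ℕ → Prop) : IsClosed {x : Pt | isAdmissible M x} := by
  have h : {x : Pt | isAdmissible M x} =
      ⋂ i, (fun x : Pt => (x i, x (i + 1))) ⁻¹' {p : ℕ × ℕ | M p.1 p.2} := by
    ext x
    simp [isAdmissible]
  rw [h]
  exact isClosed_iInter fun i => (isClosed_discrete _).preimage (by fun_prop)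

lemma SummableVariations.continuousOn (h : SummableVariations M φ) :
    ContinuousOn φ {x | isAdmissible M x} := by
  obtain ⟨V, hV, hvar⟩ := h
  intro x hx
  rw [ContinuousWithinAt, Metric.tendsto_nhds]
  intro ε hε
  obtain ⟨k, hk, hkε⟩ :=
    ((eventually_ge_atTop 2).and (hV.tendsto_atTop_zero.eventually_lt_const hε)).exists
  have hU : ∀ᶠ y in nhds x, ∀ i ∈ Finset.range k, y i = x i := by
    rw [Filter.eventually_all_finset]
    intro i _
    exact (continuous_apply i).continuousAt.eventually_mem
      ((isOpen_discrete {x i}).mem_nhds rfl)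
  filter_upwards [nhdsWithin_le_nhds hU, self_mem_nhdsWithin] with y hy hyM
  rw [Real.dist_eq]
  exact (hvar k hk y x hyM hx fun i hi => hy i (Finset.mem_range.2 hi)).trans_lt hkε

lemma birkhoff_add (φ : Pt → ℝ) (m n : ℕ) (x : Pt) :
    birkhoff φ (m + n) x = birkhoff φ m x + birkhoff φ n (shiftMap^[m] x) := by
  simp only [birkhoff, Finset.sum_range_add, ← Function.iterate_add_apply]
  simp only [add_comm]

/-- Closing a loop of an admissible sequence into a periodic orbit changes the Birkhoff sum by a
bounded amount. -/
lemma SummableVariations.exists_birkhoff_le (h : SummableVariations M φ) :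
    ∃ C : ℝ, 0 ≤ C ∧ ∀ (x : Pt) (n : ℕ), isAdmissible M x → 0 < n → x n = x 0 →
      ∃ y, isAdmissible M y ∧ shiftMap^[n] y = y ∧ birkhoff φ n x ≤ birkhoff φ n y + C := by
  obtain ⟨V, hV, hvar⟩ := h
  have hW : Summable fun k => |V (k + 2)| := ((summable_nat_add_iff 2).2 hV).abs
  refine ⟨∑' k, |V (k + 2)|, tsum_nonneg fun _ => abs_nonneg _, fun x n hx hn hxn => ?_⟩
  have hy : isAdmissible M fun i => x (i % n) := by
    intro i
    have hlt := Nat.mod_lt i hn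
    have hM := hx (i % n)
    rcases Nat.lt_or_ge (i % n + 1) n with hi | hi
    · have : (i + 1) % n = i % n + 1 := by
        rw [← Nat.mod_add_mod, Nat.mod_eq_of_lt hi]
      simpa only [this] using hM
    · have hi' : i % n + 1 = n := by omega
      have : (i + 1) % n = 0 := by rw [← Nat.mod_add_mod, hi', Nat.mod_self]
      simpa only [this, ← hxn, hi'] using hM
  refine ⟨fun i => x (i % n), hy, ?_, ?_⟩
  · funext i
    simp [shiftMap_iterate_apply]
  rw [← sub_le_iff_le_add', birkhoff, birkhoff, ← Finset.sum_sub_distrib]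
  calc _ ≤ ∑ k ∈ Finset.range n, |V (n - 1 - k + 2)| := by
        refine Finset.sum_le_sum fun k hk => (le_abs_self _).trans ?_
        have hk := Finset.mem_range.1 hk
        refine (hvar _ (by omega) _ _ (hx.iterate k) (hy.iterate k) fun i hi => ?_).trans
          (le_abs_self _)
        simp only [shiftMap_iterate_apply]
        rcases Nat.lt_or_ge (i + k) n with hik | hik
        · rw [Nat.mod_eq_of_lt hik]
        · have : i + k = n := by omega
          rw [this, Nat.mod_self, hxn]
    _ = ∑ k ∈ Finset.range n, |V (k + 2)| :=
        Finset.sum_range_reflect (fun k => |V (k + 2)|) n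
    _ ≤ _ := hW.sum_le_tsum _ fun _ _ => abs_nonneg _

/-- If the sums of `ψ` over loops are bounded by `C` and `ψ ≤ L + g`, with `ψ ≤ g` wherever the
first letter is not in `F`, then the sums of `ψ` exceed those of `g` by a bounded amount. -/
lemma birkhoff_le_of_loops {ψ g : Pt → ℝ} {C L : ℝ} {q : ℕ} (hC : 0 ≤ C) (hL : 0 ≤ L)
    (hloop : ∀ (x : Pt) (n : ℕ), isAdmissible M x → x n = x 0 → birkhoff ψ n x ≤ C)
    (hg : ∀ x, 0 ≤ g x) (hψL : ∀ x, ψ x ≤ L + g x) (hψ : ∀ x : Pt, q < x 0 → ψ x ≤ g x)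
    (N : ℕ) : ∀ (F : Finset ℕ) (x : Pt), isAdmissible M x →
      (∀ i < N, x i ≤ q → x i ∈ F) →
      birkhoff ψ N x ≤ F.card * (C + L) + birkhoff g N x := by
  induction N using Nat.strong_induction_on with
  | _ N ih =>
  intro F x hx hF
  have hCL : 0 ≤ C + L := add_nonneg hC hL
  have hone : ∀ (f : Pt → ℝ) (z : Pt), birkhoff f 1 z = f z := fun f z => by simp [birkhoff]
  rcases Nat.eq_zero_or_pos N with rfl | hN
  · simpa [birkhoff] using mul_nonneg (Nat.cast_nonneg F.card) hCL
  by_cases h0 : q < x 0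
  · obtain ⟨m, rfl⟩ : ∃ m, N = 1 + m := ⟨N - 1, by omega⟩
    have := ih m (by omega) F _ (hx.iterate 1) fun i hi h => by
      rw [shiftMap_iterate_apply] at h ⊢
      exact hF _ (by omega) h
    rw [birkhoff_add, birkhoff_add, hone, hone]
    linarith [hψ x h0]
  · have h0F : x 0 ∈ F := hF 0 hN (not_lt.1 h0)
    have hP : (fun j => x j = x 0) 0 := rfl
    set j := Nat.findGreatest (fun j => x j = x 0) (N - 1) with hj
    have hxj : x j = x 0 := Nat.findGreatest_spec (P := fun j => x j = x 0) (Nat.zero_le _) hP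
    have hjN : j ≤ N - 1 := Nat.findGreatest_le _
    have hlast : ∀ i, j < i → i < N → x i ≠ x 0 := fun i hi hiN =>
      Nat.findGreatest_is_greatest (P := fun j => x j = x 0) hi (by omega)
    obtain ⟨m, hm⟩ : ∃ m, N = j + (1 + m) := ⟨N - 1 - j, by omega⟩
    have := ih m (by omega) (F.erase (x 0)) _ ((hx.iterate j).iterate 1) fun i hi h => by
      simp only [shiftMap_iterate_apply] at h ⊢
      exact Finset.mem_erase.2 ⟨hlast _ (by omega) (by omega), hF _ (by omega) h⟩
    rw [Finset.card_erase_of_mem h0F, Nat.cast_pred (Finset.card_pos.2 ⟨_, h0F⟩)] at this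
    have hgj : 0 ≤ birkhoff g j x := Finset.sum_nonneg fun _ _ => hg _
    rw [hm, birkhoff_add ψ, birkhoff_add ψ, birkhoff_add g, birkhoff_add g, hone, hone]
    linarith [hloop x j hx hxj, hψL (shiftMap^[j] x)]

lemma integralEReal_eq_coe_integral {μ : Measure Pt} {f : Pt → ℝ} (hf : Integrable f μ) :
    integralEReal μ f = ((∫ x, f x ∂μ : ℝ) : EReal) := by
  rw [integral_eq_lintegral_pos_part_sub_lintegral_neg_part hf, EReal.coe_sub, integralEReal,
    EReal.coe_ennreal_toReal hf.lintegral_lt_top.ne,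
    EReal.coe_ennreal_toReal (x := ∫⁻ x, ENNReal.ofReal (-f x) ∂μ) hf.neg.lintegral_lt_top.ne]

lemma InvariantProb.measurePreserving {μ : Measure Pt} (hμ : InvariantProb M μ) :
    MeasurePreserving shiftMap μ μ := ⟨measurable_shiftMap, hμ.2.2⟩

lemma InvariantProb.ae_isAdmissible {μ : Measure Pt} (hμ : InvariantProb M μ) :
    ∀ᵐ x ∂μ, isAdmissible M x := by
  have := hμ.1
  exact (prob_compl_eq_zero_iff (isClosed_isAdmissible M).measurableSet).2 hμ.2.1

lemma integrable_birkhoff {μ : Measure Pt} {f : Pt → ℝ}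
    (hμ : MeasurePreserving shiftMap μ μ) (hf : Integrable f μ) (n : ℕ) :
    Integrable (birkhoff f n) μ :=
  integrable_finsetSum _ fun i _ => (hμ.iterate i).integrable_comp_of_integrable hf

lemma integral_birkhoff {μ : Measure Pt} {f : Pt → ℝ}
    (hμ : MeasurePreserving shiftMap μ μ) (hf : Integrable f μ) (n : ℕ) :
    ∫ x, birkhoff f n x ∂μ = n * ∫ x, f x ∂μ := by
  have h : ∀ i, ∫ x, f (shiftMap^[i] x) ∂μ = ∫ x, f x ∂μ := fun i => by
    conv_rhs => rw [← (hμ.iterate i).map_eq]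
    rw [integral_map (hμ.iterate i).aemeasurable]
    rw [(hμ.iterate i).map_eq]
    exact hf.aestronglyMeasurable
  calc ∫ x, birkhoff f n x ∂μ = ∑ i ∈ Finset.range n, ∫ x, f (shiftMap^[i] x) ∂μ :=
        integral_finsetSum _ fun i _ => (hμ.iterate i).integrable_comp_of_integrable hf
    _ = n * ∫ x, f x ∂μ := by simp [h]

/-- The integral of an integrable potential against an invariant probability measure is bounded by
any upper bound for its averages over periodic orbits. -/
lemma SummableVariations.integral_le (h : SummableVariations M φ) {c : ℝ}
    (hc : ∀ (y : Pt) (n : ℕ), isAdmissible M y → 0 < n → shiftMap^[n] y = y →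
      birkhoff φ n y ≤ n * c)
    {μ : Measure Pt} (hμ : InvariantProb M μ) (hφ : Integrable φ μ) :
    ∫ x, φ x ∂μ ≤ c := by
  have := hμ.1
  have hpres := hμ.measurePreserving
  obtain ⟨C, hC, hclose⟩ := h.exists_birkhoff_le
  set ψ : Pt → ℝ := fun x => φ x - c with hψdef
  have hψ : Integrable ψ μ := hφ.sub (integrable_const c)
  have hloop : ∀ (x : Pt) (n : ℕ), isAdmissible M x → x n = x 0 → birkhoff ψ n x ≤ C := by
    intro x n hx hxn
    rcases Nat.eq_zero_or_pos n with rfl | hn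
    · simpa [birkhoff] using hC
    obtain ⟨y, hy, hyn, hle⟩ := hclose x n hx hn hxn
    have hψn : birkhoff ψ n x = birkhoff φ n x - n * c := by
      simp [birkhoff, hψdef, Finset.sum_sub_distrib]
    linarith [hc y n hy hn hyn]
  set g : ℕ → Pt → ℝ := fun q x => (if q < x 0 then max (ψ x) 0 else 0) + max (ψ x - q) 0
    with hgdef
  have hind : ∀ q : ℕ, MeasurableSet {x : Pt | q < x 0} := fun q =>
    measurableSet_lt measurable_const (measurable_pi_apply 0)
  have hgm : ∀ q, AEStronglyMeasurable (g q) μ := fun q => by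
    have := (hψ.pos_part.aestronglyMeasurable.indicator (hind q)).add
      (hψ.sub (integrable_const (q : ℝ))).pos_part.aestronglyMeasurable
    convert this using 1
    funext x
    simp [hgdef, Set.indicator]
  have hg0 : ∀ q x, 0 ≤ g q x := fun q x =>
    add_nonneg (by split_ifs <;> simp) (le_max_right _ _)
  have hgb : ∀ q x, ‖g q x‖ ≤ 2 * max (ψ x) 0 := fun q x => by
    rw [Real.norm_of_nonneg (hg0 q x), two_mul]
    refine add_le_add (by split_ifs <;> simp) (max_le_max ?_ le_rfl)
    linarith [Nat.cast_nonneg (α := ℝ) q]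
  have hbi : Integrable (fun x => 2 * max (ψ x) 0) μ := hψ.pos_part.const_mul 2
  have hgi : ∀ q, Integrable (g q) μ := fun q =>
    hbi.mono' (hgm q) (Eventually.of_forall (hgb q))
  have hlim : Tendsto (fun q => ∫ x, g q x ∂μ) atTop (nhds 0) := by
    rw [← integral_zero Pt ℝ (μ := μ)]
    refine tendsto_integral_of_dominated_convergence _ hgm hbi
      (fun q => Eventually.of_forall (hgb q)) (Eventually.of_forall fun x => ?_)
    refine tendsto_const_nhds.congr' ?_
    filter_upwards [eventually_ge_atTop (x 0), eventually_ge_atTop ⌈ψ x⌉₊] with q hq hq'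
    have : ψ x ≤ q := (Nat.le_ceil _).trans (by exact_mod_cast hq')
    simp [hgdef, not_lt.2 hq, this]
  have hle : ∀ q, ∫ x, ψ x ∂μ ≤ ∫ x, g q x ∂μ := by
    intro q
    set K : ℝ := (Finset.range (q + 1)).card * (C + q) with hK
    have hN : ∀ N : ℕ, N * ((∫ x, ψ x ∂μ) - ∫ x, g q x ∂μ) ≤ K := by
      intro N
      have hae : ∀ᵐ x ∂μ, birkhoff ψ N x ≤ K + birkhoff (g q) N x := by
        filter_upwards [hμ.ae_isAdmissible] with x hx
        refine birkhoff_le_of_loops (q := q) hC (Nat.cast_nonneg q) hloop (hg0 q)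
          (fun z => ?_) (fun z hz => ?_) N _ x hx fun i _ hi => Finset.mem_range.2 (by omega)
        · have h1 : 0 ≤ if q < z 0 then max (ψ z) 0 else 0 := by split_ifs <;> simp
          linarith [le_max_left (ψ z - q) 0]
        · simp only [hgdef, if_pos hz]
          linarith [le_max_left (ψ z) 0, le_max_right (ψ z - q) 0]
      have hint := integral_mono_ae (integrable_birkhoff hpres hψ N)
        ((integrable_const K).add (integrable_birkhoff hpres (hgi q) N)) hae
      simp only [Pi.add_apply] at hint
      rw [integral_add (integrable_const K)
          (integrable_birkhoff hpres (hgi q) N),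
        integral_birkhoff hpres hψ,
        integral_birkhoff hpres (hgi q)] at hint
      simp only [integral_const, probReal_univ, one_smul] at hint
      linarith
    by_contra! hlt
    obtain ⟨N, hN'⟩ := exists_nat_gt (K / ((∫ x, ψ x ∂μ) - ∫ x, g q x ∂μ))
    rw [div_lt_iff₀ (sub_pos.2 hlt)] at hN'
    exact absurd (hN N) (not_le.2 hN')
  have hψ0 : ∫ x, ψ x ∂μ ≤ 0 := ge_of_tendsto' hlim hle
  rw [hψdef, integral_sub hφ (integrable_const c)] at hψ0
  simpa using hψ0

/-- The uniform probability measure on a periodic orbit of period `n`. -/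
noncomputable def orbitMeasure (x : Pt) (n : ℕ) : Measure Pt :=
  (n : ℝ≥0∞)⁻¹ • ∑ i ∈ Finset.range n, Measure.dirac (shiftMap^[i] x)

lemma invariantProb_orbitMeasure {n : ℕ} (hx : isAdmissible M x) (hn : 0 < n)
    (hxn : shiftMap^[n] x = x) : InvariantProb M (orbitMeasure x n) := by
  have hn0 : (n : ℝ≥0∞) ≠ 0 := by exact_mod_cast hn.ne'
  refine ⟨⟨?_⟩, ?_, ?_⟩
  · simp [orbitMeasure, ENNReal.inv_mul_cancel hn0]
  · have h : ∀ i, Measure.dirac (shiftMap^[i] x) {x : Pt | isAdmissible M x} = 1 := fun i =>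
      Measure.dirac_apply_of_mem (hx.iterate i)
    simp [orbitMeasure, h, ENNReal.inv_mul_cancel hn0]
  · have h : Finset.sum (Finset.range n) (fun i => Measure.dirac (shiftMap^[i + 1] x)) =
        ∑ i ∈ Finset.range n, Measure.dirac (shiftMap^[i] x) := by
      obtain ⟨m, rfl⟩ : ∃ m, n = m + 1 := ⟨n - 1, by omega⟩
      rw [Finset.sum_range_succ, hxn, Finset.sum_range_succ']
      rfl
    rw [orbitMeasure, Measure.map_smul, ← Measure.mapₗ_apply_of_measurable measurable_shiftMap,
      map_sum]
    simp only [Measure.mapₗ_apply_of_measurable measurable_shiftMap,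
      Measure.map_dirac' measurable_shiftMap, ← Function.iterate_succ_apply', h]

lemma integrable_orbitMeasure (φ : Pt → ℝ) (x : Pt) {n : ℕ} (hn : 0 < n) :
    Integrable φ (orbitMeasure x n) := by
  refine Integrable.smul_measure ?_ (by simpa using hn.ne')
  exact integrable_finsetSum_measure.2 fun i _ => integrable_dirac (by simp)

lemma integral_orbitMeasure (φ : Pt → ℝ) (x : Pt) (n : ℕ) :
    ∫ y, φ y ∂orbitMeasure x n = birkhoff φ n x / n := by
  rw [orbitMeasure, integral_smul_measure,
    integral_finsetSum_measure fun i _ => integrable_dirac (by simp)]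
  simp [birkhoff, div_eq_inv_mul]

end CMS

/-- `χ_per(φ) = sup { ∫ φ dμ : μ ∈ M(Σ) }`.
For a topologically transitive countable Markov shift with the F-property and a
potential `φ` with summable variations and `P(φ) < ∞`,
`χ_per(φ) = sup { ∫ φ dμ }`, the supremum being over all `σ`-invariant Borel
probability measures `μ` on `Σ` for which `∫ φ dμ` is well defined in
`[-∞, ∞)`, i.e. `∫ φ⁺ dμ < ∞`. -/
theorem chiPer_eq_sup_integrals
    (M : ℕ → ℕ → Prop) (φ : Pt → ℝ)
    (htrans : TopTransitive M) (hF : FProperty M)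
    (hsum : SummableVariations M φ)
    (P : ℝ) (hP : ∀ a : ℕ, pressureAt M φ a = (P : EReal)) :
    chiPer M φ =
      ⨆ μ : {μ : MeasureTheory.Measure Pt // InvariantProb M μ ∧
        (∫⁻ x, ENNReal.ofReal (φ x) ∂μ) < ⊤},
        integralEReal μ.1 φ := by
  apply le_antisymm
  · refine iSup_le fun ⟨⟨x, n⟩, hx, hn, hxn⟩ => ?_
    have hint := integrable_orbitMeasure φ x hn
    refine le_iSup_of_le ⟨orbitMeasure x n, invariantProb_orbitMeasure hx hn hxn,
      hint.lintegral_lt_top⟩ ?_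
    rw [integralEReal_eq_coe_integral hint, integral_orbitMeasure]
  · refine iSup_le fun ⟨μ, hμ, hpos⟩ => EReal.le_of_forall_lt_iff_le.1 fun c hc => ?_
    have hm : AEStronglyMeasurable φ μ := by
      have := hsum.continuousOn.aestronglyMeasurable (μ := μ)
        (isClosed_isAdmissible M).measurableSet
      rwa [Measure.restrict_eq_self_of_ae_mem (s := {x | isAdmissible M x})
        hμ.ae_isAdmissible] at this
    by_cases hneg : ∫⁻ x, ENNReal.ofReal (-(φ x)) ∂μ = ⊤
    · simp [integralEReal, hneg]
    have hint : Integrable φ μ := by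
      refine ⟨hm, ?_⟩
      rw [hasFiniteIntegral_iff_norm]
      calc ∫⁻ x, ENNReal.ofReal ‖φ x‖ ∂μ
          ≤ ∫⁻ x, (ENNReal.ofReal (φ x) + ENNReal.ofReal (-(φ x))) ∂μ := by
            refine lintegral_mono fun x => ?_
            rcases abs_cases (φ x) with h | h <;> simp [Real.norm_eq_abs, h.1]
        _ = (∫⁻ x, ENNReal.ofReal (φ x) ∂μ) + ∫⁻ x, ENNReal.ofReal (-(φ x)) ∂μ :=
            lintegral_add_left' hm.aemeasurable.ennreal_ofReal _
        _ < ⊤ := ENNReal.add_lt_top.2 ⟨hpos, lt_top_iff_ne_top.2 hneg⟩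
    rw [integralEReal_eq_coe_integral hint, EReal.coe_le_coe_iff]
    refine hsum.integral_le (fun y n hy hn hyn => ?_) hμ hint
    have hle : ((birkhoff φ n y / (n : ℝ) : ℝ) : EReal) ≤ chiPer M φ :=
      le_iSup (fun p : {p : Pt × ℕ // isAdmissible M p.1 ∧ 0 < p.2 ∧ shiftMap^[p.2] p.1 = p.1} =>
        ((birkhoff φ p.1.2 p.1.1 / (p.1.2 : ℝ) : ℝ) : EReal)) ⟨(y, n), hy, hn, hyn⟩
    have := EReal.coe_lt_coe_iff.1 (hle.trans_lt hc)
    rw [div_lt_iff₀ (by exact_mod_cast hn)] at this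
    linarith
end
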